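/- arXiv:1504.04195 — 3 statements merged into one kernel-verified Lean document; each statement's English description precedes it below -/
import Mathlib

section
/- For every integer n ≥ 10, q(EP_n) > q(EP'_n) > q(K_{n−6}) = 2n − 14. -/
open SimpleGraph

/-- A graph is claw-free if it contains no induced `K_{1,3}`. -/
def ClawFree {V : Type*} (G : SimpleGraph V) : Prop :=
  ¬ ∃ v a b c : V, a ≠ b ∧ a ≠ c ∧ b ≠ c ∧
    G.Adj v a ∧ G.Adj v b ∧ G.Adj v c ∧ ¬ G.Adj a b ∧ ¬ G.Adj a c ∧ ¬ G.Adj b c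

/-- A graph is traceable if it has a Hamilton path. -/
def Traceable {V : Type*} (G : SimpleGraph V) : Prop := by
  classical
  exact ∃ (u v : V) (p : G.Walk u v), p.IsHamiltonian

/-- A graph is 2-connected if it has at least 3 vertices and deleting any
single vertex leaves a connected graph. -/
def TwoConnected {V : Type*} [Fintype V] (G : SimpleGraph V) : Prop :=
  3 ≤ Fintype.card V ∧ ∀ v : V, (G.induce ({v}ᶜ : Set V)).Connected

/-- A vertex is eligible if its neighbourhood induces a connected non-complete graph. -/
def Eligible {V : Type*} (G : SimpleGraph V) (x : V) : Prop :=
  (G.induce (G.neighborSet x)).Connected ∧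
    ∃ u v : V, G.Adj x u ∧ G.Adj x v ∧ u ≠ v ∧ ¬ G.Adj u v

/-- A claw-free graph is closed if it has no eligible vertex. -/
def IsClosedGraph {V : Type*} (G : SimpleGraph V) : Prop := ∀ x : V, ¬ Eligible G x

/-- The spectral radius of a graph: the largest eigenvalue of its adjacency matrix. -/
noncomputable def adjSpectralRadius {V : Type*} [Fintype V] (G : SimpleGraph V) : ℝ := by
  classical
  exact sSup {μ : ℝ | ∃ x : V → ℝ, x ≠ 0 ∧ (G.adjMatrix ℝ).mulVec x = μ • x}

/-- The `Q`-index of a graph: the largest eigenvalue of `Q = D + A`. -/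
noncomputable def qIndex {V : Type*} [Fintype V] (G : SimpleGraph V) : ℝ := by
  classical
  exact sSup {μ : ℝ | ∃ x : V → ℝ, x ≠ 0 ∧
    (Matrix.diagonal (fun v => (G.degree v : ℝ)) + G.adjMatrix ℝ).mulVec x = μ • x}

/-- `EN n`: the complete graph on `{0, …, n-4}` together with pendant vertices
`n-3, n-2, n-1` attached to `0, 1, 2` respectively. -/
def ENgraph (n : ℕ) : SimpleGraph (Fin n) :=
  SimpleGraph.fromRel (fun i j =>
    (i.val < n - 3 ∧ j.val < n - 3) ∨ j.val = i.val + (n - 3))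

/-- `EP n`: a clique on `{0,…,n-7}` with `a_i = i`, a triangle `b_i = n-6+i`,
and vertices `c_i = n-3+i` with edges `a_i b_i`, `a_i c_i`, `b_i c_i` (`i = 0,1,2`). -/
def EPgraph (n : ℕ) : SimpleGraph (Fin n) :=
  SimpleGraph.fromRel (fun i j =>
    (i.val < n - 6 ∧ j.val < n - 6) ∨
    (n - 6 ≤ i.val ∧ i.val < n - 3 ∧ n - 6 ≤ j.val ∧ j.val < n - 3) ∨
    (i.val < 3 ∧ (j.val = i.val + (n - 6) ∨ j.val = i.val + (n - 3))) ∨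
    (n - 6 ≤ i.val ∧ i.val < n - 3 ∧ j.val = i.val + 3))

/-- `EP' n`: a clique on `{0,…,n-7}` with `a₁ = 0`, `b₁ = 1`, `c₁ = 2`, triangles
`a₁a₂a₃` and `b₁b₂b₃` where `a₂ = n-6`, `a₃ = n-5`, `b₂ = n-4`, `b₃ = n-3`, and
vertices `c₂ = n-2`, `c₃ = n-1` with edges `a_i b_i`, `a_i c_i`, `b_i c_i` for `i = 2,3`. -/
def EP'graph (n : ℕ) : SimpleGraph (Fin n) :=
  SimpleGraph.fromRel (fun i j =>
    (i.val < n - 6 ∧ j.val < n - 6) ∨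
    (i.val = 0 ∧ (j.val = n - 6 ∨ j.val = n - 5)) ∨
    (i.val = 1 ∧ (j.val = n - 4 ∨ j.val = n - 3)) ∨
    (i.val = n - 6 ∧ (j.val = n - 5 ∨ j.val = n - 4 ∨ j.val = n - 2)) ∨
    (i.val = n - 5 ∧ (j.val = n - 3 ∨ j.val = n - 1)) ∨
    (i.val = n - 4 ∧ (j.val = n - 3 ∨ j.val = n - 2)) ∨
    (i.val = n - 3 ∧ j.val = n - 1))

open Classical in
/-- The entry of `Q x = (D + A) x` at `v`. -/
noncomputable def signlessRow {V : Type*} [Fintype V] (G : SimpleGraph V) (x : V → ℝ) (v : V) : ℝ :=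
  ∑ w, if G.Adj v w then x v + x w else 0

open Classical in
lemma qMatrix_mulVec_apply {V : Type*} [Fintype V] (G : SimpleGraph V) (x : V → ℝ) (v : V) :
    (Matrix.diagonal (fun v => (G.degree v : ℝ)) + G.adjMatrix ℝ).mulVec x v =
      signlessRow G x v := by
  rw [signlessRow, Matrix.add_mulVec, Pi.add_apply, Matrix.mulVec_diagonal,
    SimpleGraph.adjMatrix_mulVec_apply, ← Finset.sum_filter, ← SimpleGraph.neighborFinset_eq_filter, Finset.sum_add_distrib]
  simp

lemma qIndex_eq_sSup {V : Type*} [Fintype V] (G : SimpleGraph V) :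
    qIndex G = sSup {μ : ℝ | ∃ x : V → ℝ, x ≠ 0 ∧ ∀ v, signlessRow G x v = μ * x v} := by
  classical
  simp only [qIndex, funext_iff, qMatrix_mulVec_apply, Pi.smul_apply, smul_eq_mul]

/-- A positive vector `y` with `Q y ≤ μ y` bounds every eigenvalue of `Q` by `μ`. -/
lemma eigenvalue_le_of_pos {V : Type*} [Fintype V] (G : SimpleGraph V) {μ ν : ℝ} {x y : V → ℝ}
    (hy : ∀ v, 0 < y v) (hyμ : ∀ v, signlessRow G y v ≤ μ * y v)
    (hx : x ≠ 0) (hxν : ∀ v, signlessRow G x v = ν * x v) : ν ≤ μ := by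
  classical
  obtain ⟨u, hu⟩ := Function.ne_iff.mp hx
  obtain ⟨v, -, hv⟩ := Finset.exists_max_image Finset.univ (fun v => |x v| / y v) ⟨u, by simp⟩
  have hρ : 0 < |x v| / y v :=
    (div_pos (abs_pos.mpr hu) (hy u)).trans_le (hv u (Finset.mem_univ u))
  set ρ := |x v| / y v
  have hxy : ∀ w, |x w| ≤ ρ * y w := fun w =>
    (div_le_iff₀ (hy w)).mp (hv w (Finset.mem_univ w))
  have hvv : |x v| = ρ * y v := (div_mul_cancel₀ _ (hy v).ne').symm
  have key : ν * (ρ * y v) ≤ ρ * (μ * y v) := calc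
    ν * (ρ * y v) ≤ |ν * x v| := by
      rw [abs_mul, ← hvv]; gcongr; exact le_abs_self ν
    _ = |∑ w, if G.Adj v w then x v + x w else 0| := by rw [← hxν, signlessRow]
    _ ≤ ∑ w, |if G.Adj v w then x v + x w else 0| := Finset.abs_sum_le_sum_abs _ _
    _ ≤ ∑ w, ρ * (if G.Adj v w then y v + y w else 0) := by
      refine Finset.sum_le_sum fun w _ => ?_
      split_ifs
      · linarith [abs_add_le (x v) (x w), hxy w, hxy v]
      · simp
    _ = ρ * signlessRow G y v := by rw [signlessRow, Finset.mul_sum]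
    _ ≤ ρ * (μ * y v) := by gcongr; exact hyμ v
  have hpos : 0 < ρ * y v := mul_pos hρ (hy v)
  exact le_of_mul_le_mul_right (by linarith) hpos

lemma qIndex_le_of_pos {V : Type*} [Fintype V] (G : SimpleGraph V) {μ : ℝ} (hμ : 0 ≤ μ) {y : V → ℝ}
    (hy : ∀ v, 0 < y v) (hyμ : ∀ v, signlessRow G y v ≤ μ * y v) :
    qIndex G ≤ μ := by
  rw [qIndex_eq_sSup]
  exact Real.sSup_le (fun ν ⟨x, hx, hxν⟩ => eigenvalue_le_of_pos G hy hyμ hx hxν) hμ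

lemma le_qIndex {V : Type*} [Fintype V] (G : SimpleGraph V) {μ : ℝ} {x : V → ℝ} (hx : x ≠ 0)
    (hxμ : ∀ v, signlessRow G x v = μ * x v) : μ ≤ qIndex G := by
  rw [qIndex_eq_sSup]
  refine le_csSup ⟨2 * Fintype.card V, ?_⟩ ⟨x, hx, hxμ⟩
  rintro ν ⟨z, hz, hzν⟩
  refine eigenvalue_le_of_pos G (y := fun _ => 1) (fun _ => one_pos) (fun v => ?_) hz hzν
  calc signlessRow G (fun _ => 1) v ≤ ∑ _w : V, (2 : ℝ) :=
        Finset.sum_le_sum fun w _ => by split_ifs <;> norm_num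
    _ = 2 * Fintype.card V * 1 := by simp [mul_comm]

lemma qIndex_top (m : ℕ) [NeZero m] : qIndex (⊤ : SimpleGraph (Fin m)) = 2 * (m : ℝ) - 2 := by
  have h1 : (1 : ℝ) ≤ m := by exact_mod_cast NeZero.one_le
  have h : ∀ v : Fin m, signlessRow ⊤ (fun _ => 1) v = (2 * (m : ℝ) - 2) * 1 := fun v => by
    have : ∀ w : Fin m, (if v ≠ w then (1 : ℝ) + 1 else 0) = 2 - if v = w then 2 else 0 :=
      fun w => by split_ifs <;> simp_all; norm_num
    simp only [signlessRow, SimpleGraph.top_adj, this, Finset.sum_sub_distrib]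
    simp [mul_comm]
  refine le_antisymm (qIndex_le_of_pos _ (by linarith) (y := fun _ => 1) (fun _ => one_pos)
    fun v => (h v).le) (le_qIndex _ (x := fun _ => 1) ?_ h)
  exact Function.ne_iff.mpr ⟨0, by simp⟩

lemma sum_range_ite_ne {k j : ℕ} (hj : j < k) (c : ℝ) :
    (∑ i ∈ Finset.range k, if i = j then 0 else c) = (k - 1) * c := by
  have : ∀ i, (if i = j then 0 else c) = c - if i = j then c else 0 := fun i => by
    split_ifs <;> simp
  simp only [this, Finset.sum_sub_distrib]
  simp [hj]
  ring

/-- The vector on the vertices of `EP (k + 9)` that is `a`, `r`, `b`, `c` on the respective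
classes of the equitable partition. -/
def EPvec (k : ℕ) (a r b c : ℝ) (i : ℕ) : ℝ :=
  if i < 3 then a else if i < k + 3 then r else if i < k + 6 then b else c

open Classical in
/-- A row of `Q x` for a graph on `Fin (k + 9)` given by a relation of natural numbers, with the
block of vertices `3, …, k + 2` kept as a sum. -/
lemma signlessRow_fromRel (k : ℕ) (R : ℕ → ℕ → Prop) (x g : ℕ → ℝ) (v : Fin (k + 9))
    (hg : ∀ w, g w = if v.val ≠ w ∧ (R v w ∨ R w v) then x v + x w else 0) :
    signlessRow (SimpleGraph.fromRel fun i j : Fin (k + 9) => R i j) (fun i => x i) v =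
    (∑ i ∈ Finset.range k, g (i + 3)) + g 0 + g 1 + g 2 + g (k + 3) + g (k + 4) +
      g (k + 5) + g (k + 6) + g (k + 7) + g (k + 8) := by
  have h3 : ∑ i ∈ Finset.range (k + 3), g i =
      (∑ i ∈ Finset.range k, g (i + 3)) + g 0 + g 1 + g 2 := by
    simp only [Finset.sum_range_succ']
    ring
  rw [← h3]
  simp only [← Finset.sum_range_succ]
  refine Eq.trans (Finset.sum_congr rfl fun w _ => ?_) (Fin.sum_univ_eq_sum_range g (k + 9))
  simp only [hg, SimpleGraph.fromRel_adj, ne_eq, Fin.ext_iff]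

lemma fin_cases_clique {k : ℕ} (v : Fin (k + 9)) : v.val = 0 ∨ v.val = 1 ∨ v.val = 2 ∨
    (∃ j < k, v.val = j + 3) ∨ v.val = k + 3 ∨ v.val = k + 4 ∨ v.val = k + 5 ∨ v.val = k + 6 ∨
    v.val = k + 7 ∨ v.val = k + 8 := by
  by_cases h : 3 ≤ v.val ∧ v.val < k + 3
  · exact Or.inr <| Or.inr <| Or.inr <| Or.inl ⟨v - 3, by omega, by omega⟩
  · omega

/-- The relation on natural numbers underlying `EPgraph n`. -/
def EPrel (n i j : ℕ) : Prop :=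
  (i < n - 6 ∧ j < n - 6) ∨
  (n - 6 ≤ i ∧ i < n - 3 ∧ n - 6 ≤ j ∧ j < n - 3) ∨
  (i < 3 ∧ (j = i + (n - 6) ∨ j = i + (n - 3))) ∨
  (n - 6 ≤ i ∧ i < n - 3 ∧ j = i + 3)

lemma signlessRow_EPgraph (k : ℕ) {μ a r b c : ℝ}
    (ha : (k + 6) * a + k * r + b + c = μ * a) (hr : (2 * k + 1) * r + 3 * a = μ * r)
    (hb : 6 * b + a + c = μ * b) (hc : 2 * c + a + b = μ * c) (v : Fin (k + 9)) :
    signlessRow (EPgraph (k + 9)) (fun i => EPvec k a r b c i) v = μ * EPvec k a r b c v := by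
  classical
  refine (signlessRow_fromRel k (EPrel (k + 9)) (EPvec k a r b c) _ v fun w => rfl).trans ?_
  rcases fin_cases_clique v with h | h | h | ⟨j, hj, h⟩ | h | h | h | h | h | h
  case inr.inr.inr.inl =>
    rw [Finset.sum_congr rfl (g := fun i => if i = j then 0 else r + r)]
    · rw [sum_range_ite_ne hj]
      simp only [h, EPvec, EPrel, Nat.reduceSubDiff]
      simp (disch := omega) only [if_pos, if_neg]
      linarith
    · intro i hi
      have := Finset.mem_range.mp hi
      simp only [h, EPvec, EPrel, Nat.reduceSubDiff]
      by_cases hij : i = j <;> simp (disch := omega) only [if_pos, if_neg]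
  case inl | inr.inl | inr.inr.inl =>
    rw [Finset.sum_congr rfl (g := fun _ => a + r)]
    · rw [Finset.sum_const, Finset.card_range, nsmul_eq_mul]
      simp only [h, EPvec, EPrel, Nat.reduceSubDiff]
      simp (disch := omega) only [if_pos, if_neg]
      linarith
    · intro i hi
      have := Finset.mem_range.mp hi
      simp only [h, EPvec, EPrel, Nat.reduceSubDiff]
      simp (disch := omega) only [if_pos, if_neg]
  all_goals
    rw [Finset.sum_eq_zero]
    · simp only [h, EPvec, EPrel, Nat.reduceSubDiff]
      simp (disch := omega) only [if_pos, if_neg, and_true]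
      linarith
    · intro i hi
      have := Finset.mem_range.mp hi
      simp only [h, EPvec, EPrel, Nat.reduceSubDiff]
      simp (disch := omega) only [if_neg]

/-- The vector on the vertices of `EP' (k + 9)` that is `a`, `r`, `b`, `c` on the respective
classes of the equitable partition. -/
def EP'vec (k : ℕ) (a r b c : ℝ) (i : ℕ) : ℝ :=
  if i < 2 then a else if i < k + 3 then r else if i < k + 7 then b else c

/-- The relation on natural numbers underlying `EP'graph n`. -/
def EP'rel (n i j : ℕ) : Prop :=
  (i < n - 6 ∧ j < n - 6) ∨
  (i = 0 ∧ (j = n - 6 ∨ j = n - 5)) ∨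
  (i = 1 ∧ (j = n - 4 ∨ j = n - 3)) ∨
  (i = n - 6 ∧ (j = n - 5 ∨ j = n - 4 ∨ j = n - 2)) ∨
  (i = n - 5 ∧ (j = n - 3 ∨ j = n - 1)) ∨
  (i = n - 4 ∧ (j = n - 3 ∨ j = n - 2)) ∨
  (i = n - 3 ∧ j = n - 1)

lemma signlessRow_EP'graph (k : ℕ) {μ a r b c : ℝ}
    (ha : (k + 5) * a + (k + 1) * r + 2 * b = μ * a) (hr : (2 * k + 2) * r + 2 * a = μ * r)
    (hb : 6 * b + a + c = μ * b) (hc : 2 * c + 2 * b = μ * c) (v : Fin (k + 9)) :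
    signlessRow (EP'graph (k + 9)) (fun i => EP'vec k a r b c i) v = μ * EP'vec k a r b c v := by
  classical
  refine (signlessRow_fromRel k (EP'rel (k + 9)) (EP'vec k a r b c) _ v fun w => rfl).trans ?_
  rcases fin_cases_clique v with h | h | h | ⟨j, hj, h⟩ | h | h | h | h | h | h
  case inr.inr.inr.inl =>
    rw [Finset.sum_congr rfl (g := fun i => if i = j then 0 else r + r)]
    · rw [sum_range_ite_ne hj]
      simp only [h, EP'vec, EP'rel, Nat.reduceSubDiff]
      simp (disch := omega) only [if_pos, if_neg, true_and, and_true, true_or, or_true]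
      linarith
    · intro i hi
      have := Finset.mem_range.mp hi
      simp only [h, EP'vec, EP'rel, Nat.reduceSubDiff]
      by_cases hij : i = j <;> simp (disch := omega) only [if_pos, if_neg]
  case inr.inr.inl =>
    rw [Finset.sum_congr rfl (g := fun _ => r + r)]
    · rw [Finset.sum_const, Finset.card_range, nsmul_eq_mul]
      simp only [h, EP'vec, EP'rel, Nat.reduceSubDiff]
      simp (disch := omega) only [if_pos, if_neg, true_and, and_true, true_or, or_true]
      linarith
    · intro i hi
      have := Finset.mem_range.mp hi
      simp only [h, EP'vec, EP'rel, Nat.reduceSubDiff]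
      simp (disch := omega) only [if_pos, if_neg]
  case inl | inr.inl =>
    rw [Finset.sum_congr rfl (g := fun _ => a + r)]
    · rw [Finset.sum_const, Finset.card_range, nsmul_eq_mul]
      simp only [h, EP'vec, EP'rel, Nat.reduceSubDiff]
      simp (disch := omega) only [if_pos, if_neg, true_and, and_true, true_or, or_true]
      linarith
    · intro i hi
      have := Finset.mem_range.mp hi
      simp only [h, EP'vec, EP'rel, Nat.reduceSubDiff]
      simp (disch := omega) only [if_pos, if_neg, true_and]
  all_goals
    rw [Finset.sum_eq_zero]
    · simp only [h, EP'vec, EP'rel, Nat.reduceSubDiff]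
      simp (disch := omega) only [if_pos, if_neg, true_and, and_true, true_or, or_true]
      linarith
    · intro i hi
      have := Finset.mem_range.mp hi
      simp only [h, EP'vec, EP'rel, Nat.reduceSubDiff]
      simp (disch := omega) only [if_neg]

lemma le_qIndex_EPgraph (k : ℕ) {D t : ℝ} (ht : 0 < t)
    (hD : D = (2 * k - 2 + t) * (2 * k + 2 + t) - 2) (hD0 : 0 < D)
    (h : (D + 1) * (t ^ 2 + (k + 1) * t - 6) = (4 * k + 2 + 2 * t) * (t + 3)) :
    2 * k + 4 + t ≤ qIndex (EPgraph (k + 9)) := by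
  refine le_qIndex _ (x := fun i => EPvec k ((D + 1) * (t + 3)) (3 * (D + 1))
    ((2 * k + 3 + t) * (t + 3)) ((2 * k - 1 + t) * (t + 3)) i) ?_
    (signlessRow_EPgraph k ?_ ?_ ?_ ?_)
  · refine Function.ne_iff.mpr ⟨0, ?_⟩
    have : 0 < (D + 1) * (t + 3) := by positivity
    simpa [EPvec] using this.ne'
  · linear_combination -h
  · ring
  · rw [hD]; ring
  · rw [hD]; ring

lemma qIndex_EP'graph (k : ℕ) {D t : ℝ} (ht : 0 < t)
    (hD : D = (2 * k - 2 + t) * (2 * k + 2 + t) - 2) (hD0 : 0 < D)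
    (h : D * (t ^ 2 + (k + 1) * t - 4) = 2 * (2 * k + 2 + t) * (t + 2)) :
    qIndex (EP'graph (k + 9)) = 2 * k + 4 + t := by
  have hpos : ∀ i : Fin (k + 9), 0 < EP'vec k (D * (t + 2)) (2 * D)
      ((2 * k + 2 + t) * (t + 2)) (2 * (t + 2)) i := fun i => by
    unfold EP'vec
    split_ifs <;> positivity
  have hrow := signlessRow_EP'graph k (μ := 2 * k + 4 + t) (a := D * (t + 2)) (r := 2 * D)
    (b := (2 * k + 2 + t) * (t + 2)) (c := 2 * (t + 2)) (by linear_combination -h) (by ring)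
    (by rw [hD]; ring) (by ring)
  exact le_antisymm (qIndex_le_of_pos _ (by positivity) hpos fun v => (hrow v).le)
    (le_qIndex _ (Function.ne_iff.mpr ⟨0, (hpos 0).ne'⟩) hrow)

/-- The root `t` of the characteristic equation for `EP' (k + 9)`. -/
lemma exists_EP'_root {K : ℝ} (hK : 2 ≤ K) : ∃ t, 0 < t ∧ t < 4 ∧
    t + 2 < (2 * K - 4 + t) * (2 * K + t) - 2 ∧
    ((2 * K - 4 + t) * (2 * K + t) - 2) * (t ^ 2 + K * t - 4) = 2 * (2 * K + t) * (t + 2) := by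
  set F : ℝ → ℝ := fun t => ((2 * K - 4 + t) * (2 * K + t) - 2) * (t ^ 2 + K * t - 4) -
    2 * (2 * K + t) * (t + 2) with hF
  have hs0 : 0 < 2 / K := by positivity
  have hs1 : 2 / K ≤ 1 := (div_le_one (by linarith)).mpr hK
  have hsK : 2 / K * K = 2 := div_mul_cancel₀ _ (by linarith)
  generalize 2 / K = s at *
  have hFs : F s < 0 := by
    have h1 : 0 < (2 * K - 4 + s) * (2 * K + s) - 2 := by nlinarith
    have h2 : s ^ 2 + K * s - 4 < 0 := by nlinarith
    have h3 := mul_neg_of_pos_of_neg h1 h2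
    have h4 : 0 < 2 * (2 * K + s) * (s + 2) := by positivity
    simp only [hF]; linarith
  have hF4 : 0 < F 4 := by
    have h1 : 4 * K * K - 2 ≥ 14 := by nlinarith
    simp only [hF]; nlinarith [mul_nonneg (sub_nonneg.mpr h1) (sub_nonneg.mpr hK)]
  obtain ⟨t, ⟨hst, ht4⟩, ht⟩ := intermediate_value_Ioo (by linarith : s ≤ 4)
    (f := F) (by fun_prop) ⟨hFs, hF4⟩
  have htK : 2 < t * K := by nlinarith
  refine ⟨t, by linarith, ht4, ?_, by simp only [hF] at ht; linarith⟩
  rcases le_total t 1 with h | h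
  · nlinarith [mul_nonneg (sub_nonneg.mpr h) (by linarith : 0 ≤ 4 - t)]
  · nlinarith [mul_nonneg (sub_nonneg.mpr hK) (by linarith : 0 ≤ t)]

/-- The characteristic equation for `EP (k + 9)` has a larger root than that for `EP' (k + 9)`. -/
lemma exists_EP_root {K t : ℝ} (hK : 2 ≤ K) (ht0 : 0 < t) (ht4 : t < 4)
    (htD : t + 2 < (2 * K - 4 + t) * (2 * K + t) - 2)
    (ht : ((2 * K - 4 + t) * (2 * K + t) - 2) * (t ^ 2 + K * t - 4) =
      2 * (2 * K + t) * (t + 2)) : ∃ s, t < s ∧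
    ((2 * K - 4 + s) * (2 * K + s) - 1) * (s ^ 2 + K * s - 6) =
      (4 * K - 2 + 2 * s) * (s + 3) := by
  set G : ℝ → ℝ := fun s => ((2 * K - 4 + s) * (2 * K + s) - 1) * (s ^ 2 + K * s - 6) -
    (4 * K - 2 + 2 * s) * (s + 3) with hG
  have hGt : G t < 0 := by
    generalize hDD : (2 * K - 4 + t) * (2 * K + t) - 2 = D at ht htD
    have h1 : D * G t = 2 * (2 * K + t + D) * (t + 2 - D) := by
      simp only [hG, show (2 * K - 4 + t) * (2 * K + t) - 1 = D + 1 by linarith]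
      linear_combination (D + 1) * ht
    have h2 : 2 * (2 * K + t + D) * (t + 2 - D) < 0 :=
      mul_neg_of_pos_of_neg (by linarith) (by linarith)
    nlinarith
  have hG4 : 0 < G 4 := by
    have h1 : 4 * K * K - 1 ≥ 15 := by nlinarith
    simp only [hG]; nlinarith [mul_nonneg (sub_nonneg.mpr h1) (sub_nonneg.mpr hK)]
  obtain ⟨s, ⟨hts, -⟩, hs⟩ := intermediate_value_Ioo ht4.le (f := G) (by fun_prop) ⟨hGt, hG4⟩
  exact ⟨s, hts, by simp only [hG] at hs; linarith⟩

theorem statement_11 (n : ℕ) (hn : 10 ≤ n) :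
    qIndex (EPgraph n) > qIndex (EP'graph n) ∧
    qIndex (EP'graph n) > qIndex (⊤ : SimpleGraph (Fin (n - 6))) ∧
    qIndex (⊤ : SimpleGraph (Fin (n - 6))) = 2 * (n : ℝ) - 14 := by
  obtain ⟨k, rfl⟩ : ∃ k, n = k + 9 := ⟨n - 9, by omega⟩
  have hK : (2 : ℝ) ≤ k + 1 := by
    have : (1 : ℝ) ≤ k := by exact_mod_cast (by omega : 1 ≤ k)
    linarith
  obtain ⟨t, ht0, ht4, htD, ht⟩ := exists_EP'_root hK
  obtain ⟨s, hts, hs⟩ := exists_EP_root hK ht0 ht4 htD ht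
  have hsD : 0 < (2 * (k : ℝ) - 2 + s) * (2 * k + 2 + s) - 2 := by nlinarith
  have hEP' := qIndex_EP'graph k ht0 rfl (by linarith) (by linear_combination ht)
  have hEP := le_qIndex_EPgraph k (ht0.trans hts) rfl hsD (by linear_combination hs)
  have htop : qIndex (⊤ : SimpleGraph (Fin (k + 9 - 6))) = 2 * k + 4 := by
    rw [show k + 9 - 6 = k + 3 from rfl, qIndex_top]
    push_cast
    ring
  refine ⟨by linarith, by linarith, ?_⟩
  rw [htop]
  push_cast
  ring
end

section
/- For every integer n ≥ 10, the spectral radius μ_1 = μ(EP_n) satisfies the equation (μ_1 − n + 10)(μ_1³ − 4μ_1² + μ_1 + 2) − (3n − 27)(μ_1² − 2μ_1 − 1) = 0. -/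
open SimpleGraph

/-- An eigenvalue with a positive eigenvector bounds every eigenvalue of a nonnegative matrix. -/
theorem eigenvalue_le_of_pos_eigenvector {ι : Type*} [Fintype ι] {A : Matrix ι ι ℝ}
    (hA : ∀ i j, 0 ≤ A i j) {x : ι → ℝ} (hx : ∀ i, 0 < x i) {r : ℝ}
    (hr : A.mulVec x = r • x) {y : ι → ℝ} (hy : y ≠ 0) {μ : ℝ}
    (hμ : A.mulVec y = μ • y) : μ ≤ r := by
  obtain ⟨k, hk⟩ := Function.ne_iff.mp hy
  have hk' : 0 < |y k| := abs_pos.mpr hk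
  obtain ⟨i, -, hi⟩ :=
    Finset.exists_max_image Finset.univ (fun i => |y i| / x i) ⟨k, Finset.mem_univ k⟩
  set t := |y i| / x i
  have hle : ∀ j, |y j| ≤ t * x j := fun j => (div_le_iff₀ (hx j)).mp (hi j (Finset.mem_univ j))
  have htpos : 0 < t := (div_pos hk' (hx k)).trans_le (hi k (Finset.mem_univ k))
  have hyi : |y i| = t * x i := (div_mul_cancel₀ _ (hx i).ne').symm
  have h₁ : ∑ j, A i j * y j = μ * y i := congrFun hμ i
  have h₂ : ∑ j, A i j * x j = r * x i := congrFun hr i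
  have h₃ : |μ| * |y i| ≤ r * |y i| := calc
    |μ| * |y i| = |∑ j, A i j * y j| := by rw [h₁, abs_mul]
    _ ≤ ∑ j, |A i j * y j| := Finset.abs_sum_le_sum_abs _ _
    _ ≤ ∑ j, t * (A i j * x j) := Finset.sum_le_sum fun j _ => by
        rw [abs_mul, abs_of_nonneg (hA i j), mul_left_comm]
        exact mul_le_mul_of_nonneg_left (hle j) (hA i j)
    _ = r * |y i| := by rw [← Finset.mul_sum, h₂, hyi]; ring
  have hpos : 0 < |y i| := hyi ▸ mul_pos htpos (hx i)
  exact (le_abs_self μ).trans (le_of_mul_le_mul_right h₃ hpos)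

/-- A graph with a positive eigenvector has the corresponding eigenvalue as spectral radius. -/
theorem adjSpectralRadius_eq_of_pos_eigenvector {V : Type*} [Fintype V] [Nonempty V]
    (G : SimpleGraph V) [DecidableRel G.Adj] {x : V → ℝ} (hx : ∀ v, 0 < x v) {r : ℝ}
    (hr : (G.adjMatrix ℝ).mulVec x = r • x) : adjSpectralRadius G = r := by
  unfold adjSpectralRadius
  refine IsGreatest.csSup_eq ⟨⟨x, fun h => ?_, ?_⟩, ?_⟩
  · exact (hx (Classical.arbitrary V)).ne' (congrFun h _)
  · convert hr
  · rintro μ ⟨y, hy, hμ⟩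
    refine eigenvalue_le_of_pos_eigenvector (fun i j => ?_) hx hr hy (μ := μ) ?_
    · rw [SimpleGraph.adjMatrix_apply]
      split_ifs <;> norm_num
    · convert hμ

/-- The vector constant on the orbits of the `a_i`, the other clique vertices, the `b_i` and
the `c_i` of `EPgraph n`. -/
def epVector (n : ℕ) (a d b c : ℝ) (k : ℕ) : ℝ :=
  if k < 3 then a else if k < n - 6 then d else if k < n - 3 then b else c

/-- A quotient eigenvector of `EPgraph n` lifts to an eigenvector of its adjacency matrix. -/
theorem EPgraph_mulVec_epVector {n : ℕ} (hn : 10 ≤ n) [DecidableRel (EPgraph n).Adj]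
    {a d b c r : ℝ} (ha : 2 * a + ((n : ℝ) - 9) * d + b + c = r * a)
    (hd : 3 * a + ((n : ℝ) - 10) * d = r * d) (hb : a + 2 * b + c = r * b) (hc : a + b = r * c) :
    ((EPgraph n).adjMatrix ℝ).mulVec (fun i => epVector n a d b c i) =
      r • fun i : Fin n => epVector n a d b c i := by
  obtain ⟨m, rfl⟩ := Nat.exists_eq_add_of_le' hn
  push_cast at ha hd
  ext ⟨i, hi⟩
  rw [SimpleGraph.adjMatrix_mulVec_apply, SimpleGraph.neighborFinset_eq_filter, Finset.sum_filter]
  simp only [EPgraph, SimpleGraph.fromRel_adj, Pi.smul_apply, smul_eq_mul, ne_eq, Fin.ext_iff]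
  let R : ℕ → ℕ → Prop := fun i j =>
    (i < m + 4 ∧ j < m + 4) ∨ (m + 4 ≤ i ∧ i < m + 7 ∧ m + 4 ≤ j ∧ j < m + 7) ∨
    (i < 3 ∧ (j = i + (m + 4) ∨ j = i + (m + 7))) ∨ (m + 4 ≤ i ∧ i < m + 7 ∧ j = i + 3)
  have key := Fin.sum_univ_eq_sum_range
    (fun k => if ¬ i = k ∧ (R i k ∨ R k i) then epVector (m + 10) a d b c k else 0) (m + 10)
  refine Eq.trans ?_ (key.trans ?_)
  · refine Finset.sum_congr rfl fun j _ => ?_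
    congr 1
  iterate 6 rw [Finset.sum_range_succ]
  iterate 3 rw [Finset.sum_range_succ']
  have hmid : ∀ l < m + 1, ∑ k ∈ Finset.range (m + 1), (if k = l then 0 else d) = m * d := by
    intro l hl
    have h : ∀ k, (if k = l then 0 else d) = d - if k = l then d else 0 := fun k => by
      split_ifs <;> simp
    simp only [h, Finset.sum_sub_distrib, Finset.sum_ite_eq', Finset.mem_range, hl, if_true,
      Finset.sum_const, Finset.card_range, nsmul_eq_mul]
    push_cast
    ring
  have hsum : (∑ k ∈ Finset.range (m + 1),
      if ¬ i = k + 1 + 1 + 1 ∧ (R i (k + 1 + 1 + 1) ∨ R (k + 1 + 1 + 1) i) then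
        epVector (m + 10) a d b c (k + 1 + 1 + 1) else 0) =
      if i < 3 then (m + 1) * d else if i < m + 4 then m * d else 0 := by
    have hval : ∀ k ∈ Finset.range (m + 1), epVector (m + 10) a d b c (k + 1 + 1 + 1) = d := by
      intro k hk
      rw [Finset.mem_range] at hk
      simp (disch := omega) only [epVector, if_pos, if_neg]
    split_ifs with h₁ h₂
    · rw [Finset.sum_congr rfl fun k hk => (if_pos ?_).trans (hval k hk)]
      · simp
      · rw [Finset.mem_range] at hk
        simp only [R]
        omega
    · rw [← hmid (i - 3) (by omega)]
      refine Finset.sum_congr rfl fun k hk => ?_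
      rw [hval k hk]
      rw [Finset.mem_range] at hk
      by_cases h : k = i - 3
      · rw [if_pos h, if_neg (by omega)]
      · rw [if_neg h, if_pos (by simp only [R]; omega)]
    · refine Finset.sum_eq_zero fun k hk => if_neg ?_
      rw [Finset.mem_range] at hk
      simp only [R]
      omega
  rw [hsum]
  simp only [R, epVector]
  have hcases : i = 0 ∨ i = 1 ∨ i = 2 ∨ (3 ≤ i ∧ i < m + 4) ∨ i = m + 4 ∨ i = m + 5 ∨
      i = m + 6 ∨ i = m + 7 ∨ i = m + 8 ∨ i = m + 9 := by
    omega
  rcases hcases with rfl | rfl | rfl | ⟨h₁, h₂⟩ | rfl | rfl | rfl | rfl | rfl | rfl <;>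
    simp (disch := first | omega | simp) only [if_pos, if_neg] <;>
    linarith

/-- The quotient characteristic polynomial of `EPgraph n` has a root that is at least `n - 7`. -/
theorem exists_EPgraph_root {n : ℝ} (hn : 10 ≤ n) :
    ∃ r : ℝ, n - 7 ≤ r ∧ (r - n + 10) * (r ^ 3 - 4 * r ^ 2 + r + 2) -
      (3 * n - 27) * (r ^ 2 - 2 * r - 1) = 0 := by
  have hcont : ContinuousOn (fun r : ℝ => (r - n + 10) * (r ^ 3 - 4 * r ^ 2 + r + 2) -
      (3 * n - 27) * (r ^ 2 - 2 * r - 1)) (Set.Icc (n - 7) n) := by fun_prop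
  obtain ⟨r, hr, h⟩ := intermediate_value_Icc (by linarith) hcont <| show (0 : ℝ) ∈ _ from
    ⟨by nlinarith, by
      obtain ⟨k, hk, rfl⟩ : ∃ k : ℝ, 0 ≤ k ∧ n = k + 10 := ⟨n - 10, by linarith, by ring⟩
      ring_nf
      positivity⟩
  exact ⟨r, hr.1, h⟩

theorem statement_13 (n : ℕ) (hn : 10 ≤ n) :
    (adjSpectralRadius (EPgraph n) - (n : ℝ) + 10) *
        ((adjSpectralRadius (EPgraph n)) ^ 3 - 4 * (adjSpectralRadius (EPgraph n)) ^ 2 +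
          adjSpectralRadius (EPgraph n) + 2) -
      (3 * (n : ℝ) - 27) *
        ((adjSpectralRadius (EPgraph n)) ^ 2 - 2 * adjSpectralRadius (EPgraph n) - 1) = 0 := by
  have hn' : (10 : ℝ) ≤ n := by exact_mod_cast hn
  obtain ⟨r, hr, h⟩ := exists_EPgraph_root hn'
  have : Nonempty (Fin n) := ⟨⟨0, by omega⟩⟩
  classical
  have hs : 0 < r - n + 10 := by linarith
  have hq : 0 < r ^ 2 - 2 * r - 1 := by nlinarith
  have hμ : adjSpectralRadius (EPgraph n) = r :=
    adjSpectralRadius_eq_of_pos_eigenvector (EPgraph n)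
      (x := fun i => epVector n ((r - n + 10) * (r ^ 2 - 2 * r - 1)) (3 * (r ^ 2 - 2 * r - 1))
        ((r + 1) * (r - n + 10)) ((r - 1) * (r - n + 10)) i)
      (fun i => by
        have h₁ : 0 < r + 1 := by linarith
        have h₂ : 0 < r - 1 := by linarith
        unfold epVector
        split_ifs <;> positivity)
      (EPgraph_mulVec_epVector hn (by linear_combination -h) (by ring) (by ring) (by ring))
  rw [hμ]
  exact h
end

section
/- For every integer n ≥ 10, the spectral radius μ_2 of the complement of EP'_n satisfies the equation (μ_2² − 4n + 32)(μ_2² − 2) − (2μ_2² + μ_2)(μ_2 + 2) − (2n − 16)(μ_2² + μ_2 + 2) = 0. -/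
open SimpleGraph

/-- If the adjacency matrix of a graph has an entrywise positive eigenvector, then the
corresponding eigenvalue is the spectral radius. -/
theorem adjSpectralRadius_eq_of_pos_eigenvector_s18 {V : Type*} [Fintype V] [Nonempty V]
    (G : SimpleGraph V) [DecidableRel G.Adj] {μ : ℝ} {v : V → ℝ} (hv : ∀ i, 0 < v i)
    (h : ∀ i, ∑ j, (if G.Adj i j then v j else 0) = μ * v i) :
    adjSpectralRadius G = μ := by
  classical
  unfold adjSpectralRadius
  refine IsGreatest.csSup_eq ⟨⟨v, ?_, ?_⟩, ?_⟩
  · intro h0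
    obtain ⟨i⟩ := ‹Nonempty V›
    exact (hv i).ne' (congrFun h0 i)
  · ext i
    rw [Pi.smul_apply, smul_eq_mul, ← h i]
    simp only [Matrix.mulVec, dotProduct, adjMatrix_apply, ite_mul, one_mul, zero_mul]
  · rintro l ⟨x, hx, hxl⟩
    have key : ∀ i, l * |x i| ≤ ∑ j, (if G.Adj i j then |x j| else 0) := by
      intro i
      have hi := congrFun hxl i
      simp only [Matrix.mulVec, dotProduct, adjMatrix_apply, ite_mul, one_mul, zero_mul,
        Pi.smul_apply, smul_eq_mul] at hi
      calc l * |x i| ≤ |l * x i| := by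
            rw [abs_mul]; exact mul_le_mul_of_nonneg_right (le_abs_self l) (abs_nonneg _)
        _ = |∑ j, (if G.Adj i j then x j else 0)| := by
            rw [← hi]
        _ ≤ ∑ j, |if G.Adj i j then x j else 0| := Finset.abs_sum_le_sum_abs _ _
        _ = _ := Finset.sum_congr rfl fun j _ => by split_ifs <;> simp
    have hpos : 0 < ∑ i, v i * |x i| := by
      obtain ⟨i, hi⟩ := Function.ne_iff.mp hx
      exact Finset.sum_pos' (fun j _ => mul_nonneg (hv j).le (abs_nonneg _))
        ⟨i, Finset.mem_univ i, mul_pos (hv i) (abs_pos.mpr hi)⟩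
    refine le_of_mul_le_mul_right ?_ hpos
    calc l * ∑ i, v i * |x i| = ∑ i, v i * (l * |x i|) := by
          rw [Finset.mul_sum]; exact Finset.sum_congr rfl fun i _ => by ring
      _ ≤ ∑ i, v i * ∑ j, (if G.Adj i j then |x j| else 0) :=
          Finset.sum_le_sum fun i _ => mul_le_mul_of_nonneg_left (key i) (hv i).le
      _ = ∑ j, (∑ i, if G.Adj j i then v i else 0) * |x j| := by
          simp only [Finset.mul_sum, Finset.sum_mul]
          rw [Finset.sum_comm]
          exact Finset.sum_congr rfl fun i _ => Finset.sum_congr rfl fun j _ => by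
            simp only [G.adj_comm i j]; split_ifs <;> simp
      _ = μ * ∑ i, v i * |x i| := by
          rw [Finset.mul_sum]
          exact Finset.sum_congr rfl fun j _ => by rw [h j]; ring

/-- The relation on vertex labels that generates the adjacency of `EP' (m + 8)`. -/
def EP'Rel (m i j : ℕ) : Prop :=
    (i < m + 2 ∧ j < m + 2) ∨
    (i = 0 ∧ (j = m + 2 ∨ j = m + 3)) ∨
    (i = 1 ∧ (j = m + 4 ∨ j = m + 5)) ∨
    (i = m + 2 ∧ (j = m + 3 ∨ j = m + 4 ∨ j = m + 6)) ∨
    (i = m + 3 ∧ (j = m + 5 ∨ j = m + 7)) ∨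
    (i = m + 4 ∧ (j = m + 5 ∨ j = m + 6)) ∨
    (i = m + 5 ∧ j = m + 7)

/-- Adjacency in the complement of `EP' (m + 8)`, in terms of vertex labels. -/
def EP'ComplRel (m i j : ℕ) : Prop :=
  i ≠ j ∧ ¬ (i ≠ j ∧ (EP'Rel m i j ∨ EP'Rel m j i))

theorem compl_EP'graph_adj (m : ℕ) (i j : Fin (m + 8)) :
    (EP'graph (m + 8))ᶜ.Adj i j ↔ EP'ComplRel m i j := by
  simp only [EP'ComplRel, EP'graph, compl_adj, fromRel_adj, ne_eq, Fin.ext_iff]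
  rfl

/-- The vector on the vertices of `EP' (m + 8)` that is constant on the four orbits
`{a₁, b₁}`, `C \ {a₁, b₁}`, `{a₂, a₃, b₂, b₃}` and `{c₂, c₃}`. -/
def EP'orbitVector (m : ℕ) (a k x c : ℝ) (i : ℕ) : ℝ :=
  if i < 2 then a else if i < m + 2 then k else if i < m + 6 then x else c

theorem sum_range_add_eight {m : ℕ} {f : ℕ → ℝ} {K : ℝ} (hf : ∀ j < m, f (j + 2) = K) :
    ∑ j ∈ Finset.range (m + 8), f j = f 0 + f 1 + m * K +
      f (m + 2) + f (m + 3) + f (m + 4) + f (m + 5) + f (m + 6) + f (m + 7) := by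
  have hK : ∑ j ∈ Finset.range m, f (j + 2) = m * K := by
    rw [Finset.sum_congr rfl fun j hj => hf j (Finset.mem_range.mp hj)]
    simp
  rw [← hK, show m + 8 = (m + 2) + 6 from rfl]
  iterate 6 rw [Finset.sum_range_succ]
  iterate 2 rw [Finset.sum_range_succ']
  ring

open Classical in
theorem sum_adj_compl_EP'graph (m : ℕ) (a k x c μ : ℝ) (ha : 2 * x + 2 * c = μ * a)
    (hk : 4 * x + 2 * c = μ * k) (hx : m * k + a + x + c = μ * x)
    (hc : m * k + 2 * a + 2 * x + c = μ * c) (i : Fin (m + 8)) :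
    ∑ j : Fin (m + 8), (if (EP'graph (m + 8))ᶜ.Adj i j then EP'orbitVector m a k x c j else 0) =
      μ * EP'orbitVector m a k x c i := by
  obtain ⟨i, hi⟩ := i
  simp only [compl_EP'graph_adj]
  rw [Fin.sum_univ_eq_sum_range (fun j => if EP'ComplRel m i j then
    EP'orbitVector m a k x c j else 0)]
  obtain h | h | h : (2 ≤ i ∧ i < m + 2) ∨ i < 2 ∨ m + 2 ≤ i := by omega
  · rw [sum_range_add_eight (K := 0) fun j hj =>
      if_neg (by unfold EP'ComplRel EP'Rel; omega)]
    unfold EP'orbitVector EP'ComplRel EP'Rel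
    simp (disch := omega) only [if_pos, if_neg]
    linear_combination hk
  · rw [sum_range_add_eight (K := 0) fun j hj =>
      if_neg (by unfold EP'ComplRel EP'Rel; omega)]
    unfold EP'orbitVector EP'ComplRel EP'Rel
    interval_cases i <;> simp <;> linear_combination ha
  · have hmid : ∀ j < m, (if EP'ComplRel m i (j + 2) then EP'orbitVector m a k x c (j + 2)
        else 0) = k := fun j hj => by
      rw [if_pos (by unfold EP'ComplRel EP'Rel; omega)]
      unfold EP'orbitVector
      rw [if_neg (by omega), if_pos (by omega)]
    rw [sum_range_add_eight (K := k) hmid]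
    unfold EP'orbitVector EP'ComplRel EP'Rel
    obtain rfl | rfl | rfl | rfl | rfl | rfl : i = m + 2 ∨ i = m + 3 ∨ i = m + 4 ∨ i = m + 5 ∨
      i = m + 6 ∨ i = m + 7 := by omega
    all_goals
      simp
      first | linear_combination hx | linear_combination hc

/-- The quartic factor of the characteristic polynomial of the complement of `EP' (m + 8)` has a
root exceeding `2`. -/
theorem exists_root_compl_EP'graph (m : ℝ) (hm : 0 ≤ m) :
    ∃ μ : ℝ, 2 < μ ∧ μ ^ 4 - 2 * μ ^ 3 - 7 * μ ^ 2 - 2 * μ - m * (6 * μ ^ 2 + 2 * μ - 4) = 0 := by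
  have hcont : ContinuousOn (fun μ : ℝ => μ ^ 4 - 2 * μ ^ 3 - 7 * μ ^ 2 - 2 * μ -
      m * (6 * μ ^ 2 + 2 * μ - 4)) (Set.Icc 2 (6 * m + 10)) := by fun_prop
  obtain ⟨μ, ⟨hμ, -⟩, h⟩ := intermediate_value_Icc (by linarith) hcont
    (show (0 : ℝ) ∈ Set.Icc _ _ by
      refine ⟨by norm_num; linarith, ?_⟩
      ring_nf
      positivity)
  refine ⟨μ, lt_of_le_of_ne hμ ?_, h⟩
  rintro rfl
  norm_num at h
  linarith

theorem statement_18 (n : ℕ) (hn : 10 ≤ n) :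
    ((adjSpectralRadius (EP'graph n)ᶜ) ^ 2 - 4 * (n : ℝ) + 32) *
        ((adjSpectralRadius (EP'graph n)ᶜ) ^ 2 - 2) -
      (2 * (adjSpectralRadius (EP'graph n)ᶜ) ^ 2 + adjSpectralRadius (EP'graph n)ᶜ) *
        (adjSpectralRadius (EP'graph n)ᶜ + 2) -
      (2 * (n : ℝ) - 16) *
        ((adjSpectralRadius (EP'graph n)ᶜ) ^ 2 + adjSpectralRadius (EP'graph n)ᶜ + 2) = 0 := by
  obtain ⟨m, rfl⟩ : ∃ m, n = m + 8 := ⟨n - 8, by omega⟩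
  obtain ⟨μ, hμ, hroot⟩ := exists_root_compl_EP'graph m m.cast_nonneg
  classical
  have hμ0 : μ ≠ 0 := by linarith
  have hsq : 4 < μ ^ 2 := by nlinarith
  have hrad : adjSpectralRadius (EP'graph (m + 8))ᶜ = μ := by
    refine adjSpectralRadius_eq_of_pos_eigenvector_s18 _
      (v := fun i => EP'orbitVector m (4 * μ + 2) ((6 * μ ^ 2 + 2 * μ - 4) / μ) (μ ^ 2 - 2)
        (μ ^ 2 + μ + 2) i) (fun i => ?_) (fun i => ?_)
    · have hk : 0 < (6 * μ ^ 2 + 2 * μ - 4) / μ := div_pos (by linarith) (by linarith)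
      unfold EP'orbitVector
      split_ifs <;> first | exact hk | linarith
    · convert sum_adj_compl_EP'graph m _ _ _ _ μ ?_ ?_ ?_ ?_ i
      · ring
      · field_simp
        ring
      · field_simp
        linear_combination -hroot
      · field_simp
        linear_combination -hroot
  rw [hrad]
  push_cast
  linear_combination hroot
end
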